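/- For each m ∈ Z, the Q(q^{1/2})-algebra homomorphism L_m : Q(q^{1/2})⊗_{Q(q)}U_q^-(g) → Â[m] determined by f_i ↦ f_{i,m} is an isomorphism. -/

import Mathlib

/- Common setting: a symmetrizable generalized Cartan matrix, the field
`𝕂 = ℚ(q^{1/2})` (with `sqv = q^{1/2}` and `q = qh = sqv²`), quantum integers, the bosonic
extension `hA A` presented by the `q`-Serre relations and the bosonic commutation
relations, its weight spaces and distinguished subalgebras, and the root-lattice
pairing. -/

set_option maxHeartbeats 1000000
set_option synthInstance.maxHeartbeats 400000

noncomputable section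

structure GCM (I : Type) where
  c : I → I → ℤ
  d : I → ℤ
  d_pos : ∀ i, 0 < d i
  diag : ∀ i, c i i = 2
  offdiag : ∀ i j, i ≠ j → c i j ≤ 0
  dsymm : ∀ i j, d i * c i j = d j * c j i

abbrev 𝕂 : Type := RatFunc ℚ

/-- The square root `q^{1/2}` of `q`. -/
def sqv : 𝕂 := RatFunc.X

/-- The indeterminate `q = (q^{1/2})²`. -/
def qh : 𝕂 := sqv ^ 2

def qNum (t : 𝕂) (n : ℕ) : 𝕂 := (t ^ n - t⁻¹ ^ n) / (t - t⁻¹)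

def qFact (t : 𝕂) (n : ℕ) : 𝕂 := ∏ k ∈ Finset.range n, qNum t (k + 1)

def qBinom (t : 𝕂) (m k : ℕ) : 𝕂 := qFact t m / (qFact t k * qFact t (m - k))

variable {I : Type} [DecidableEq I]

/-- `q_i = q^{d_i}`. -/
def qd (A : GCM I) (i : I) : 𝕂 := qh ^ A.d i

/-- `ζ_i = 1 - q_i²`. -/
def zi (A : GCM I) (i : I) : 𝕂 := 1 - qd A i ^ 2

/-- The `q`-Serre element `Σ_{k=0}^{b_{ij}} (-1)^k [b_{ij} choose k]_{q_i} a^k b a^{b_{ij}-k}`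
for elements `a, b` of any `𝕂`-algebra, where `b_{ij} = 1 - c_{ij}`. -/
def serreIn {R : Type} [Ring R] [Algebra 𝕂 R] (A : GCM I) (i j : I) (a b : R) : R :=
  ∑ k ∈ Finset.range ((1 - A.c i j).toNat + 1),
    ((-1 : 𝕂) ^ k * qBinom (qd A i) ((1 - A.c i j).toNat) k) •
      (a ^ k * b * a ^ ((1 - A.c i j).toNat - k))

/-- The defining relations of the bosonic extension: (a) for each `p`, the `q`-Serre
relations among the `f_{i,p}`; (b) for `m < p`,
`f_{i,m} f_{j,p} = q^{(-1)^{p-m+1}(α_i,α_j)} f_{j,p} f_{i,m} + δ_{(j,p),(i,m+1)}(1-q_i²)`. -/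
inductive hARel (A : GCM I) : FreeAlgebra 𝕂 (I × ℤ) → FreeAlgebra 𝕂 (I × ℤ) → Prop
  | serre (i j : I) (p : ℤ) (h : i ≠ j) :
      hARel A (serreIn A i j (FreeAlgebra.ι 𝕂 (i, p)) (FreeAlgebra.ι 𝕂 (j, p))) 0
  | comm (i j : I) (m p : ℤ) (h : m < p) :
      hARel A (FreeAlgebra.ι 𝕂 (i, m) * FreeAlgebra.ι 𝕂 (j, p))
        (qh ^ (((p - m + 1).negOnePow : ℤ) * (A.d i * A.c i j)) •
            (FreeAlgebra.ι 𝕂 (j, p) * FreeAlgebra.ι 𝕂 (i, m))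
          + if j = i ∧ p = m + 1 then ((1 : 𝕂) - qd A i ^ 2) • 1 else 0)

/-- The bosonic extension `Â` associated with the generalized Cartan matrix. -/
abbrev hA (A : GCM I) : Type := RingQuot (hARel A)

/-- The generator `f_{i,p}` of the bosonic extension. -/
def ff (A : GCM I) (i : I) (p : ℤ) : hA A :=
  RingQuot.mkAlgHom 𝕂 (hARel A) (FreeAlgebra.ι 𝕂 (i, p))

/-- The symmetric bilinear pairing on the root lattice, `(α_i, α_j) = d_i c_{ij}`. -/
def ip (A : GCM I) (β γ : I →₀ ℤ) : ℤ :=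
  β.sum fun i a => γ.sum fun j b => a * b * (A.d i * A.c i j)

/-- `α_{i,m} = (-1)^m α_i` as an element of the root lattice. -/
def aim (i : I) (m : ℤ) : I →₀ ℤ := Finsupp.single i ((m.negOnePow : ℤ))

/-- The weight space of weight `β` of `Â`, where `wt (f_{i,p}) = (-1)^{p+1} α_i`. -/
def hAwt (A : GCM I) (β : I →₀ ℤ) : Submodule 𝕂 (hA A) :=
  Submodule.span 𝕂 {x | ∃ l : List (I × ℤ),
    (l.map fun p => Finsupp.single p.1 (((p.2 + 1).negOnePow : ℤ))).sum = β ∧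
    x = (l.map fun p => ff A p.1 p.2).prod}

/-- The subalgebra `Â[a,b]` generated by `{f_{i,k} | a ≤ k ≤ b}`. -/
def hAband (A : GCM I) (a b : ℤ) : Subalgebra 𝕂 (hA A) :=
  Algebra.adjoin 𝕂 {x | ∃ i k, a ≤ k ∧ k ≤ b ∧ x = ff A i k}

/-- The subalgebra `Â[m]`. -/
def hAk (A : GCM I) (m : ℤ) : Subalgebra 𝕂 (hA A) := hAband A m m

/-- The subalgebra `Â_{≥ m}`. -/
def hAge (A : GCM I) (m : ℤ) : Subalgebra 𝕂 (hA A) :=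
  Algebra.adjoin 𝕂 {x | ∃ i k, m ≤ k ∧ x = ff A i k}

/-- The subalgebra `Â_{≤ m}`. -/
def hAle (A : GCM I) (m : ℤ) : Subalgebra 𝕂 (hA A) :=
  Algebra.adjoin 𝕂 {x | ∃ i k, k ≤ m ∧ x = ff A i k}

/-- The subalgebra `Â_{> m}`. -/
def hAgt (A : GCM I) (m : ℤ) : Subalgebra 𝕂 (hA A) := hAge A (m + 1)

/-- The subalgebra `Â_{< m}`. -/
def hAlt (A : GCM I) (m : ℤ) : Subalgebra 𝕂 (hA A) := hAle A (m - 1)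

/-- The `q`-Serre relations for `U_q^-(g)` (with scalars extended to `ℚ(q^{1/2})`). -/
inductive URel (A : GCM I) : FreeAlgebra 𝕂 I → FreeAlgebra 𝕂 I → Prop
  | serre (i j : I) (h : i ≠ j) :
      URel A (serreIn A i j (FreeAlgebra.ι 𝕂 i) (FreeAlgebra.ι 𝕂 j)) 0

/-- `ℚ(q^{1/2}) ⊗_{ℚ(q)} U_q^-(g)`. -/
abbrev Uq (A : GCM I) : Type := RingQuot (URel A)

/-- The generator `f_i` of `U_q^-(g)`. -/
def fg (A : GCM I) (i : I) : Uq A :=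
  RingQuot.mkAlgHom 𝕂 (URel A) (FreeAlgebra.ι 𝕂 i)

/-- The weight space of weight `β` of `U_q^-(g)`, where `wt (f_i) = -α_i`. -/
def Uwt (A : GCM I) (β : I →₀ ℤ) : Submodule 𝕂 (Uq A) :=
  Submodule.span 𝕂 {x | ∃ l : List I,
    -((l.map fun i => Finsupp.single i (1 : ℤ)).sum) = β ∧ x = (l.map (fg A)).prod}

/-- A base `t` for which no quantum integer `[n+1]_t` vanishes. -/
def QGeneric (t : 𝕂) : Prop := t ≠ 0 ∧ ∀ n : ℕ, qNum t (n + 1) ≠ 0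

lemma sqv_pow_ne_one {n : ℕ} (hn : n ≠ 0) : sqv ^ n ≠ 1 := by
  intro h
  have h' : algebraMap (Polynomial ℚ) 𝕂 (Polynomial.X ^ n) = algebraMap (Polynomial ℚ) 𝕂 1 := by
    rw [map_pow, RatFunc.algebraMap_X, map_one]
    exact h
  have := congrArg Polynomial.natDegree (RatFunc.algebraMap_injective ℚ h')
  simp at this
  exact hn this

lemma sqv_ne_zero : sqv ≠ 0 := RatFunc.X_ne_zero

lemma qh_ne_zero : qh ≠ 0 := pow_ne_zero _ sqv_ne_zero

lemma QGeneric.of_pow_ne_one {t : 𝕂} (h0 : t ≠ 0) (h1 : ∀ n : ℕ, n ≠ 0 → t ^ n ≠ 1) :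
    QGeneric t := by
  have key : ∀ n : ℕ, t ^ (n + 1) - t⁻¹ ^ (n + 1) ≠ 0 := by
    intro n h
    rw [inv_pow, sub_eq_zero, ← mul_eq_one_iff_eq_inv₀ (pow_ne_zero _ h0), ← pow_add] at h
    exact h1 _ (by omega) h
  refine ⟨h0, fun n => div_ne_zero (key n) ?_⟩
  simpa using key 0

set_option linter.unusedSectionVars false

lemma qd_generic (A : GCM I) (i : I) : QGeneric (qd A i) := by
  refine QGeneric.of_pow_ne_one (zpow_ne_zero _ qh_ne_zero) fun n hn => ?_
  obtain ⟨e, he⟩ := Int.eq_ofNat_of_zero_le (A.d_pos i).le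
  have hpos := A.d_pos i
  rw [qd, qh, he, zpow_natCast, ← pow_mul, ← pow_mul]
  refine sqv_pow_ne_one ?_
  have : e ≠ 0 := by rintro rfl; simp [he] at hpos
  positivity

lemma qFact_zero (t : 𝕂) : qFact t 0 = 1 := Finset.prod_range_zero _

lemma qFact_succ (t : 𝕂) (n : ℕ) : qFact t (n + 1) = qFact t n * qNum t (n + 1) :=
  Finset.prod_range_succ _ _

lemma QGeneric.qFact_ne_zero {t : 𝕂} (ht : QGeneric t) (n : ℕ) : qFact t n ≠ 0 :=
  Finset.prod_ne_zero_iff.2 fun k _ => ht.2 k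

lemma QGeneric.sub_inv_ne_zero {t : 𝕂} (ht : QGeneric t) : t - t⁻¹ ≠ 0 := by
  intro h
  have := ht.2 0
  simp [qNum, h] at this

lemma QGeneric.qBinom_zero {t : 𝕂} (ht : QGeneric t) (n : ℕ) : qBinom t n 0 = 1 := by
  have := ht.qFact_ne_zero n
  rw [qBinom]
  simp [this, qFact_zero]

lemma QGeneric.qBinom_self {t : 𝕂} (ht : QGeneric t) (n : ℕ) : qBinom t n n = 1 := by
  have := ht.qFact_ne_zero n
  rw [qBinom]
  simp [this, qFact_zero]

lemma qNum_add {t : 𝕂} (ht : QGeneric t) (k l : ℕ) :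
    qNum t (k + l) = t⁻¹ ^ k * qNum t l + t ^ l * qNum t k := by
  have := ht.sub_inv_ne_zero
  simp only [qNum]
  field_simp
  have h0 := ht.1
  rw [pow_add, pow_add]
  ring

lemma qNum_add' {t : 𝕂} (ht : QGeneric t) (k l : ℕ) :
    qNum t (k + l) = t ^ k * qNum t l + t⁻¹ ^ l * qNum t k := by
  rw [add_comm k l, qNum_add ht, add_comm]

lemma qBinom_succ_of_qNum {t : 𝕂} (ht : QGeneric t) {n k l : ℕ} (h : n = k + l + 1) {a b : 𝕂}
    (hab : qNum t (n + 1) = a * qNum t (l + 1) + b * qNum t (k + 1)) :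
    qBinom t (n + 1) (k + 1) = a * qBinom t n (k + 1) + b * qBinom t n k := by
  have e1 : n + 1 - (k + 1) = l + 1 := by omega
  have e2 : n - (k + 1) = l := by omega
  have e3 : n - k = l + 1 := by omega
  simp only [qBinom, e1, e2, e3, qFact_succ, hab]
  have h1 := ht.qFact_ne_zero k
  have h2 := ht.qFact_ne_zero l
  have h3 := ht.2 k
  have h4 := ht.2 l
  field_simp

/-- Gaussian binomials, extended by zero to `k > n`. -/
def qBinomExt (t : 𝕂) (n k : ℕ) : 𝕂 := if k ≤ n then qBinom t n k else 0

lemma qBinomExt_zero {t : 𝕂} (ht : QGeneric t) (n : ℕ) : qBinomExt t n 0 = 1 := by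
  simp [qBinomExt, ht.qBinom_zero]

lemma qBinomExt_succ {t : 𝕂} (ht : QGeneric t) (n k : ℕ) :
    qBinomExt t (n + 1) (k + 1) =
      t⁻¹ ^ (k + 1) * qBinomExt t n (k + 1) + t ^ n * t⁻¹ ^ k * qBinomExt t n k := by
  have h0 := ht.1
  rcases lt_trichotomy n k with h | rfl | h
  · simp [qBinomExt, show ¬ k ≤ n by omega, show ¬ k + 1 ≤ n by omega]
  · simp [qBinomExt, ht.qBinom_self, h0]
  · obtain ⟨l, rfl⟩ : ∃ l, n = k + l + 1 := ⟨n - k - 1, by omega⟩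
    simp only [qBinomExt, show k + 1 ≤ k + l + 1 by omega, show k ≤ k + l + 1 by omega,
      show k + 1 ≤ k + l + 1 + 1 by omega, if_true]
    refine qBinom_succ_of_qNum ht rfl ?_
    rw [show k + l + 1 + 1 = (k + 1) + (l + 1) by omega, qNum_add ht,
      show k + l + 1 = (l + 1) + k by omega, pow_add t (l + 1) k, mul_assoc (t ^ (l + 1)), ← mul_pow]
    simp [h0]

lemma qBinomExt_succ' {t : 𝕂} (ht : QGeneric t) (n k : ℕ) :
    qBinomExt t (n + 1) (k + 1) =
      t ^ (k + 1) * qBinomExt t n (k + 1) + t⁻¹ ^ n * t ^ k * qBinomExt t n k := by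
  have h0 := ht.1
  rcases lt_trichotomy n k with h | rfl | h
  · simp [qBinomExt, show ¬ k ≤ n by omega, show ¬ k + 1 ≤ n by omega]
  · simp [qBinomExt, ht.qBinom_self, h0]
  · obtain ⟨l, rfl⟩ : ∃ l, n = k + l + 1 := ⟨n - k - 1, by omega⟩
    simp only [qBinomExt, show k + 1 ≤ k + l + 1 by omega, show k ≤ k + l + 1 by omega,
      show k + 1 ≤ k + l + 1 + 1 by omega, if_true]
    refine qBinom_succ_of_qNum ht rfl ?_
    rw [show k + l + 1 + 1 = (k + 1) + (l + 1) by omega, qNum_add' ht,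
      show k + l + 1 = (l + 1) + k by omega, pow_add t⁻¹ (l + 1) k,
      mul_assoc (t⁻¹ ^ (l + 1)), ← mul_pow]
    simp [h0]

section SerreSum

variable {R : Type} [Ring R] [Algebra 𝕂 R]

/-- The sum `Σ_k (-μ)^k [n choose k]_t z^k u z^{n-k}`. -/
def serreSum (t : 𝕂) (n : ℕ) (μ : 𝕂) (z u : R) : R :=
  ∑ k ∈ Finset.range (n + 1), ((-μ) ^ k * qBinomExt t n k) • (z ^ k * u * z ^ (n - k))

lemma serreIn_eq_serreSum (A : GCM I) (i j : I) (a b : R) :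
    serreIn A i j a b = serreSum (qd A i) (1 - A.c i j).toNat 1 a b := by
  refine Finset.sum_congr rfl fun k hk => ?_
  rw [qBinomExt, if_pos (Nat.lt_succ_iff.1 (Finset.mem_range.1 hk))]

lemma serreSum_add (t : 𝕂) (n : ℕ) (μ : 𝕂) (z u v : R) :
    serreSum t n μ z (u + v) = serreSum t n μ z u + serreSum t n μ z v := by
  simp only [serreSum, ← Finset.sum_add_distrib, ← smul_add, mul_add, add_mul]

/-- If the coefficients satisfy a Pascal rule with weights `α^k` and `β α^{k-1}`, one factor of
the Serre sum can be split off. -/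
lemma serreSum_succ_of_pascal {t α β : 𝕂} (ht : QGeneric t) {n : ℕ}
    (h : ∀ k, qBinomExt t (n + 1) (k + 1) =
      α ^ (k + 1) * qBinomExt t n (k + 1) + β * α ^ k * qBinomExt t n k) (μ : 𝕂) (z u : R) :
    serreSum t (n + 1) μ z u = serreSum t n (μ * α) z (u * z - (μ * β) • (z * u)) := by
  have top : qBinomExt t n (n + 1) = 0 := by simp [qBinomExt]
  have lhs : serreSum t (n + 1) μ z u =
      (∑ k ∈ Finset.range (n + 2), ((-(μ * α)) ^ k * qBinomExt t n k) •
        (z ^ k * u * z ^ (n + 1 - k))) +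
      ∑ k ∈ Finset.range (n + 1), ((-μ) ^ (k + 1) * (β * α ^ k * qBinomExt t n k)) •
        (z ^ (k + 1) * u * z ^ (n - k)) := by
    rw [serreSum, Finset.sum_range_succ', Finset.sum_range_succ' _ (n + 1), add_right_comm,
      ← Finset.sum_add_distrib, qBinomExt_zero ht, qBinomExt_zero ht]
    congr 1
    · refine Finset.sum_congr rfl fun k _ => ?_
      rw [show n + 1 - (k + 1) = n - k by omega, ← add_smul, h]
      congr 1
      rw [← neg_mul, mul_pow]
      ring
  rw [lhs, Finset.sum_range_succ, top, mul_zero, zero_smul, add_zero, ← Finset.sum_add_distrib,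
    serreSum]
  refine Finset.sum_congr rfl fun k hk => ?_
  have hk' : n + 1 - k = (n - k) + 1 := by have := Finset.mem_range.1 hk; omega
  rw [mul_sub, sub_mul, smul_sub, sub_eq_add_neg, hk', pow_succ' z (n - k)]
  congr 1
  · simp only [mul_assoc]
  · rw [mul_smul_comm, smul_mul_assoc, smul_smul, ← neg_smul, pow_succ z]
    simp only [mul_assoc]
    congr 1
    rw [← neg_mul μ α, mul_pow]
    ring

lemma serreSum_succ {t : 𝕂} (ht : QGeneric t) (n : ℕ) (μ : 𝕂) (z u : R) :
    serreSum t (n + 1) μ z u = serreSum t n (μ * t⁻¹) z (u * z - (μ * t ^ n) • (z * u)) :=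
  serreSum_succ_of_pascal ht (qBinomExt_succ ht n) μ z u

lemma serreSum_succ' {t : 𝕂} (ht : QGeneric t) (n : ℕ) (μ : 𝕂) (z u : R) :
    serreSum t (n + 1) μ z u = serreSum t n (μ * t) z (u * z - (μ * t⁻¹ ^ n) • (z * u)) :=
  serreSum_succ_of_pascal ht (qBinomExt_succ' ht n) μ z u

lemma serreSum_zero (t μ : 𝕂) (z w u : R) : serreSum t 0 μ z u = serreSum t 0 μ w u := by
  simp [serreSum]

lemma serreSum_add_left {t : 𝕂} (ht : QGeneric t) {x y : R} (hxy : y * x = t ^ 2 • (x * y)) :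
    ∀ (n : ℕ) (μ ρ : 𝕂) (u : R), y * u = ρ • (u * y) → μ * t ^ n * ρ = t →
      serreSum t n μ (x + y) u = serreSum t n μ x u
  | 0, _, _, _, _, _ => serreSum_zero _ _ _ _ _
  | n + 1, μ, ρ, u, hu, hμ => by
    have h0 := ht.1
    have h1 : μ * t ^ n * ρ = 1 := by
      apply mul_left_cancel₀ h0
      rw [mul_one]
      nth_rewrite 3 [← hμ]
      ring
    rw [serreSum_succ ht, serreSum_succ ht]
    have e : u * (x + y) - (μ * t ^ n) • ((x + y) * u) = u * x - (μ * t ^ n) • (x * u) := by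
      rw [add_mul, hu, smul_add, smul_smul, h1, mul_add, one_smul]
      abel
    rw [e]
    refine serreSum_add_left ht hxy n _ (ρ * t ^ 2) _ ?_ ?_
    · rw [mul_sub, sub_mul, ← mul_assoc, hu, mul_smul_comm, ← mul_assoc, hxy, smul_mul_assoc,
        mul_assoc u, hxy, smul_mul_assoc, mul_assoc x, hu, smul_sub, smul_mul_assoc]
      simp only [mul_smul_comm, smul_smul, mul_assoc]
      congr 2
      ring
    · field_simp
      linear_combination h1

lemma serreSum_add_right {t : 𝕂} (ht : QGeneric t) {x y : R} (hxy : y * x = t ^ 2 • (x * y)) :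
    ∀ (n : ℕ) (μ ρ : 𝕂) (v : R), v * x = ρ • (x * v) → ρ * t ^ n = μ * t →
      serreSum t n μ (x + y) v = serreSum t n μ y v
  | 0, _, _, _, _, _ => serreSum_zero _ _ _ _ _
  | n + 1, μ, ρ, v, hv, hμ => by
    have h0 := ht.1
    have h1 : μ * t⁻¹ ^ n = ρ := by
      have : μ = ρ * t ^ n := by
        apply mul_right_cancel₀ h0
        rw [← hμ, pow_succ]
        ring
      rw [this, mul_assoc, ← mul_pow, mul_inv_cancel₀ h0, one_pow, mul_one]
    rw [serreSum_succ' ht, serreSum_succ' ht]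
    have e : v * (x + y) - (μ * t⁻¹ ^ n) • ((x + y) * v) =
        v * y - (μ * t⁻¹ ^ n) • (y * v) := by
      rw [mul_add, hv, add_mul, smul_add, h1]
      abel
    rw [e]
    refine serreSum_add_right ht hxy n _ (ρ * t ^ 2) _ ?_ ?_
    · rw [sub_mul, mul_sub, mul_assoc, hxy, smul_mul_assoc, mul_assoc y, hv, mul_smul_comm,
        mul_smul_comm, ← mul_assoc, hv, ← mul_assoc y x, hxy, smul_sub]
      simp only [mul_smul_comm, smul_mul_assoc, smul_smul, mul_assoc]
      congr 2
      · ring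
      · ring
    · rw [pow_succ] at hμ
      linear_combination t * hμ

end SerreSum

section SerreIn

variable {R : Type} [Ring R] [Algebra 𝕂 R] (A : GCM I)

lemma serreIn_map {S : Type} [Ring S] [Algebra 𝕂 S] (φ : R →ₐ[𝕂] S) (i j : I) (a b : R) :
    φ (serreIn A i j a b) = serreIn A i j (φ a) (φ b) := by
  simp [serreIn, map_sum]

lemma serreIn_smul (i j : I) (r s : 𝕂) (a b : R) :
    serreIn A i j (r • a) (s • b) =
      (r ^ (1 - A.c i j).toNat * s) • serreIn A i j a b := by
  simp only [serreIn, Finset.smul_sum]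
  refine Finset.sum_congr rfl fun k hk => ?_
  have hk' : (1 - A.c i j).toNat = k + ((1 - A.c i j).toNat - k) := by
    have := Finset.mem_range.1 hk
    omega
  rw [smul_pow, smul_pow, smul_mul_smul_comm, smul_mul_smul_comm, smul_smul, smul_smul]
  congr 1
  have hr : r ^ (1 - A.c i j).toNat = r ^ k * r ^ ((1 - A.c i j).toNat - k) := by
    rw [← pow_add, ← hk']
  rw [hr]
  ring

lemma SemiconjBy.serreIn {c a b a' b' : R} (ha : SemiconjBy c a a') (hb : SemiconjBy c b b')
    (i j : I) : SemiconjBy c (serreIn A i j a b) (serreIn A i j a' b') := by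
  simp only [SemiconjBy, _root_.serreIn, Finset.mul_sum, Finset.sum_mul]
  refine Finset.sum_congr rfl fun k _ => ?_
  rw [mul_smul_comm, smul_mul_assoc]
  congr 1
  exact ((ha.pow_right k).mul_right hb).mul_right (ha.pow_right _)

lemma natCast_serreDegree {i j : I} (h : i ≠ j) : ((1 - A.c i j).toNat : ℤ) = 1 - A.c i j :=
  Int.toNat_of_nonneg (by have := A.offdiag i j h; omega)

lemma serreIn_eq_zero {i j : I} (h : i ≠ j) {a b : R} (hab : a * b = 0) (hba : b * a = 0) :
    serreIn A i j a b = 0 := by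
  refine Finset.sum_eq_zero fun k _ => ?_
  have hn := natCast_serreDegree A h
  have hc := A.offdiag i j h
  obtain ⟨n, hn'⟩ : ∃ n, (1 - A.c i j).toNat = n + 1 := ⟨(1 - A.c i j).toNat - 1, by omega⟩
  rcases k with _ | k
  · rw [hn', pow_zero, pow_zero, one_mul, one_mul, Nat.sub_zero, pow_succ', ← mul_assoc, hba, zero_mul, smul_zero]
  · rw [pow_succ a, mul_assoc (a ^ k), hab, mul_zero, zero_mul, smul_zero]

/-- The `q`-Serre element is primitive for the twisted coproduct. -/
lemma serreIn_add {i j : I} (h : i ≠ j) {x u y v : R}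
    (hyx : y * x = qh ^ (A.d i * A.c i i) • (x * y))
    (hyu : y * u = qh ^ (A.d i * A.c i j) • (u * y))
    (hvx : v * x = qh ^ (A.d i * A.c i j) • (x * v)) :
    serreIn A i j (x + y) (u + v) = serreIn A i j x u + serreIn A i j y v := by
  have ht := qd_generic A i
  have h2 : qh ^ (A.d i * A.c i i) = qd A i ^ 2 := by
    rw [A.diag, qd, zpow_mul]
    rfl
  have hc : qd A i ^ (1 - A.c i j).toNat * qh ^ (A.d i * A.c i j) = qd A i := by
    rw [zpow_mul, ← qd, ← zpow_natCast, natCast_serreDegree A h, ← zpow_add₀ ht.1]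
    simp
  rw [h2] at hyx
  simp only [serreIn_eq_serreSum, serreSum_add]
  rw [serreSum_add_left ht hyx _ _ _ _ hyu (by rw [one_mul, hc]),
    serreSum_add_right ht hyx _ _ _ _ hvx (by rw [mul_comm, hc, one_mul])]

lemma serreIn_diagonal (i j : I) (a b : Fin 2 → R) :
    serreIn A i j (Matrix.diagonal a) (Matrix.diagonal b) =
      Matrix.diagonal fun s => serreIn A i j (a s) (b s) := by
  have h := serreIn_map A (Matrix.diagonalAlgHom (n := Fin 2) (α := R) 𝕂) i j a b
  rw [Matrix.diagonalAlgHom_apply, Matrix.diagonalAlgHom_apply, Matrix.diagonalAlgHom_apply] at h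
  rw [← h]
  congr 1
  funext s
  exact serreIn_map A (Pi.evalAlgHom 𝕂 (fun _ : Fin 2 => R) s) i j a b

/-- The strictly upper triangular matrix with corner `x`. -/
def corner (x : R) : Matrix (Fin 2) (Fin 2) R := !![0, x; 0, 0]

lemma corner_zero : corner (0 : R) = 0 := by
  ext r c
  fin_cases r <;> fin_cases c <;> rfl

lemma smul_corner (s : 𝕂) (x : R) : s • corner x = corner (s • x) := by
  simp [corner, Matrix.smul_of]

lemma corner_mul_corner (x y : R) : corner x * corner y = 0 := by
  ext r c
  fin_cases r <;> fin_cases c <;> simp [corner, Matrix.mul_apply]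

lemma diagonal_mul_corner (a : Fin 2 → R) (x : R) :
    Matrix.diagonal a * corner x = corner (a 0 * x) := by
  ext r c
  fin_cases r <;> fin_cases c <;> simp [corner]

lemma corner_mul_diagonal (a : Fin 2 → R) (x : R) :
    corner x * Matrix.diagonal a = corner (x * a 1) := by
  ext r c
  fin_cases r <;> fin_cases c <;> simp [corner, Matrix.mul_diagonal]

/-- An upper triangular matrix with scalar corner. -/
def upperTri (a : R) (s : 𝕂) (b : R) : Matrix (Fin 2) (Fin 2) R := !![a, s • 1; 0, b]

lemma upperTri_eq_add (a : R) (s : 𝕂) (b : R) :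
    upperTri a s b = Matrix.diagonal ![a, b] + corner (s • 1) := by
  ext r c
  fin_cases r <;> fin_cases c <;> simp [upperTri, corner]

lemma corner_mul_diagonal_twist (s r p : 𝕂) (x : R) (h : s ≠ 0 → p = r) :
    corner (s • (1 : R)) * Matrix.diagonal ![x, p • x] =
      r • (Matrix.diagonal ![x, p • x] * corner (s • 1)) := by
  rw [corner_mul_diagonal, diagonal_mul_corner, smul_corner]
  congr 1
  by_cases hs : s = 0
  · simp [hs]
  · simp [h hs, smul_smul, mul_comm]

lemma diagonal_twist_mul_corner (s r p : 𝕂) (x : R) (h : s ≠ 0 → p = r) :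
    Matrix.diagonal ![p • x, x] * corner (s • (1 : R)) =
      r • (corner (s • 1) * Matrix.diagonal ![p • x, x]) := by
  rw [corner_mul_diagonal, diagonal_mul_corner, smul_corner]
  congr 1
  by_cases hs : s = 0
  · simp [hs]
  · simp [h hs, smul_smul, mul_comm]

/-- Serre elements of upper triangular matrices whose lower diagonal is a `q`-twist of the upper
one: the corner is zero. -/
lemma serreIn_upperTri_lower {i j : I} (h : i ≠ j) (k : I) (x y : R) (s s' : 𝕂)
    (hs : s ≠ 0 → i = k) (hs' : s' ≠ 0 → j = k) :
    serreIn A i j (upperTri x s (qh ^ (A.d i * A.c i k) • x))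
        (upperTri y s' (qh ^ (A.d j * A.c j k) • y)) =
      Matrix.diagonal fun r => serreIn A i j (![x, qh ^ (A.d i * A.c i k) • x] r)
        (![y, qh ^ (A.d j * A.c j k) • y] r) := by
  rw [upperTri_eq_add, upperTri_eq_add, serreIn_add A h (x := Matrix.diagonal _)
      (u := Matrix.diagonal _), serreIn_diagonal,
    serreIn_eq_zero A h (corner_mul_corner _ _) (corner_mul_corner _ _), add_zero]
  · exact corner_mul_diagonal_twist _ _ _ _ fun h0 => by rw [hs h0]
  · exact corner_mul_diagonal_twist _ _ _ _ fun h0 => by rw [hs h0, A.dsymm j k]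
  · exact corner_mul_diagonal_twist _ _ _ _ fun h0 => by rw [hs' h0]

/-- Serre elements of upper triangular matrices whose upper diagonal is a `q`-twist of the lower
one: the corner is zero. -/
lemma serreIn_upperTri_upper {i j : I} (h : i ≠ j) (k : I) (x y : R) (s s' : 𝕂)
    (hs : s ≠ 0 → i = k) (hs' : s' ≠ 0 → j = k) :
    serreIn A i j (upperTri (qh ^ (A.d k * A.c k i) • x) s x)
        (upperTri (qh ^ (A.d k * A.c k j) • y) s' y) =
      Matrix.diagonal fun r => serreIn A i j (![qh ^ (A.d k * A.c k i) • x, x] r)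
        (![qh ^ (A.d k * A.c k j) • y, y] r) := by
  rw [upperTri_eq_add, upperTri_eq_add, add_comm, add_comm (Matrix.diagonal ![_, y]),
    serreIn_add A h (y := Matrix.diagonal _) (v := Matrix.diagonal _), serreIn_diagonal,
    serreIn_eq_zero A h (corner_mul_corner _ _) (corner_mul_corner _ _), zero_add]
  · exact diagonal_twist_mul_corner _ _ _ _ fun h0 => by rw [hs h0]
  · exact diagonal_twist_mul_corner _ _ _ _ fun h0 => by rw [hs' h0, A.dsymm k i]
  · exact diagonal_twist_mul_corner _ _ _ _ fun h0 => by rw [hs h0]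

end SerreIn

section Induction

variable {X : Type} {r : FreeAlgebra 𝕂 X → FreeAlgebra 𝕂 X → Prop}

/-- A linear subspace containing `1` and stable under left multiplication by the generators of a
presented algebra is everything. -/
lemma RingQuot.mem_of_mul_mem (W : Submodule 𝕂 (RingQuot r)) (h1 : (1 : RingQuot r) ∈ W)
    (hmul : ∀ (a : X) (y), y ∈ W → RingQuot.mkAlgHom 𝕂 r (FreeAlgebra.ι 𝕂 a) * y ∈ W)
    (x : RingQuot r) : x ∈ W := by
  obtain ⟨z, rfl⟩ := RingQuot.mkAlgHom_surjective 𝕂 r x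
  suffices h : ∀ y ∈ W, RingQuot.mkAlgHom 𝕂 r z * y ∈ W by simpa using h 1 h1
  induction z using FreeAlgebra.induction with
  | grade0 s =>
    intro y hy
    rw [AlgHom.commutes, ← Algebra.smul_def]
    exact W.smul_mem s hy
  | grade1 a => exact hmul a
  | mul a b ha hb =>
    intro y hy
    rw [map_mul, mul_assoc]
    exact ha _ (hb _ hy)
  | add a b ha hb =>
    intro y hy
    rw [map_add, add_mul]
    exact W.add_mem (ha _ hy) (hb _ hy)

end Induction

/-- The sign governing the commutation of the skew derivation `D_{i,m}` with `f_{j,r}`. -/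
def twistSign (m r : ℤ) : ℤ :=
  if r ≤ m then ((m - r).negOnePow : ℤ) else ((r - m + 1).negOnePow : ℤ)

lemma twistSign_of_lt {m p : ℤ} (h : m < p) : twistSign m p = ((p - m + 1).negOnePow : ℤ) :=
  if_neg (not_le.2 h)

lemma twistSign_swap {m p : ℤ} (h : m < p) : twistSign p m = -((p - m + 1).negOnePow : ℤ) := by
  rw [twistSign, if_pos h.le, Int.negOnePow_succ]
  simp

lemma twistSign_self (m : ℤ) : twistSign m m = 1 := by simp [twistSign]

lemma twistSign_succ_self (m : ℤ) : twistSign m (m + 1) = 1 := by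
  rw [twistSign_of_lt (by omega), show m + 1 - m + 1 = 2 by ring]
  rfl

lemma twistSign_succ_right {m p : ℤ} (h : m < p) :
    twistSign p (m + 1) = ((p - m + 1).negOnePow : ℤ) := by
  rw [twistSign, if_pos (by omega), show p - m + 1 = p - (m + 1) + 1 + 1 by ring,
    Int.negOnePow_succ, Int.negOnePow_succ]
  simp

lemma twistSign_of_lt_succ {m r : ℤ} (h : r < m + 1) :
    twistSign m r = ((m + 1 - r + 1).negOnePow : ℤ) := by
  rw [twistSign, if_pos (by omega), show m + 1 - r + 1 = m - r + 1 + 1 by ring,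
    Int.negOnePow_succ, Int.negOnePow_succ]
  simp

lemma twistSign_of_succ_lt {m s : ℤ} (h : m + 1 < s) :
    twistSign m s = -((s - (m + 1) + 1).negOnePow : ℤ) := by
  rw [twistSign_of_lt (by omega), show s - m + 1 = s - (m + 1) + 1 + 1 by ring,
    Int.negOnePow_succ]
  simp

lemma twistSign_succ_of_lt {m p : ℤ} (h : m < p) :
    twistSign m (p + 1) = -((p - m + 1).negOnePow : ℤ) := by
  rw [twistSign_of_lt (by omega), show p + 1 - m + 1 = p - m + 1 + 1 by ring,
    Int.negOnePow_succ]
  simp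

/-- The relations of the bosonic extension with the inhomogeneous terms removed. -/
inductive SkewRel (A : GCM I) : FreeAlgebra 𝕂 (I × ℤ) → FreeAlgebra 𝕂 (I × ℤ) → Prop
  | serre (i j : I) (p : ℤ) (h : i ≠ j) :
      SkewRel A (serreIn A i j (FreeAlgebra.ι 𝕂 (i, p)) (FreeAlgebra.ι 𝕂 (j, p))) 0
  | comm (i j : I) (m p : ℤ) (h : m < p) :
      SkewRel A (FreeAlgebra.ι 𝕂 (i, m) * FreeAlgebra.ι 𝕂 (j, p))
        (qh ^ (((p - m + 1).negOnePow : ℤ) * (A.d i * A.c i j)) •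
            (FreeAlgebra.ι 𝕂 (j, p) * FreeAlgebra.ι 𝕂 (i, m)))

/-- The skew tensor product of `ℤ` copies of `U_q^-(g)`. -/
def SkewT (A : GCM I) : Type := RingQuot (SkewRel A)

instance (A : GCM I) : Ring (SkewT A) := inferInstanceAs (Ring (RingQuot (SkewRel A)))

instance (A : GCM I) : Algebra 𝕂 (SkewT A) := inferInstanceAs (Algebra 𝕂 (RingQuot (SkewRel A)))

/-- The quotient map onto the skew tensor product. -/
def skewMk (A : GCM I) : FreeAlgebra 𝕂 (I × ℤ) →ₐ[𝕂] SkewT A :=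
  RingQuot.mkAlgHom 𝕂 (SkewRel A)

lemma skewMk_rel {A : GCM I} {x y : FreeAlgebra 𝕂 (I × ℤ)} (h : SkewRel A x y) :
    skewMk A x = skewMk A y := RingQuot.mkAlgHom_rel 𝕂 h

/-- The generators of the skew tensor product. -/
def tf (A : GCM I) (i : I) (p : ℤ) : SkewT A :=
  skewMk A (FreeAlgebra.ι 𝕂 (i, p))

lemma SkewT.mem_of_mul_mem {A : GCM I} (W : Submodule 𝕂 (SkewT A)) (h1 : (1 : SkewT A) ∈ W)
    (hmul : ∀ i p y, y ∈ W → tf A i p * y ∈ W) (x : SkewT A) : x ∈ W :=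
  RingQuot.mem_of_mul_mem (r := SkewRel A) W h1 (fun a => hmul a.1 a.2) x

lemma tf_serre (A : GCM I) {i j : I} (h : i ≠ j) (p : ℤ) :
    serreIn A i j (tf A i p) (tf A j p) = 0 := by
  have := skewMk_rel (SkewRel.serre (A := A) i j p h)
  rwa [serreIn_map, map_zero] at this

lemma tf_comm (A : GCM I) (i j : I) {m p : ℤ} (h : m < p) :
    tf A i m * tf A j p =
      qh ^ (((p - m + 1).negOnePow : ℤ) * (A.d i * A.c i j)) • (tf A j p * tf A i m) := by
  have := skewMk_rel (SkewRel.comm (A := A) i j m p h)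
  rwa [map_mul, map_smul, map_mul] at this

/-- Algebra homomorphisms out of the skew tensor product. -/
def skewLift (A : GCM I) {R : Type} [Ring R] [Algebra 𝕂 R] (g : I → ℤ → R)
    (hserre : ∀ i j p, i ≠ j → serreIn A i j (g i p) (g j p) = 0)
    (hcomm : ∀ i j m p, m < p → g i m * g j p =
      qh ^ (((p - m + 1).negOnePow : ℤ) * (A.d i * A.c i j)) • (g j p * g i m)) :
    SkewT A →ₐ[𝕂] R :=
  RingQuot.liftAlgHom 𝕂 ⟨FreeAlgebra.lift 𝕂 fun p => g p.1 p.2, by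
    rintro _ _ (⟨i, j, p, h⟩ | ⟨i, j, m, p, h⟩)
    · simpa [serreIn_map] using hserre i j p h
    · simpa using hcomm i j m p h⟩

lemma skewLift_tf (A : GCM I) {R : Type} [Ring R] [Algebra 𝕂 R] (g : I → ℤ → R) (hs hc)
    (i : I) (p : ℤ) : skewLift A g hs hc (tf A i p) = g i p := by
  refine (RingQuot.liftAlgHom_mkAlgHom_apply 𝕂 _ _ _).trans ?_
  exact FreeAlgebra.lift_ι_apply _ _

/-- The value of `D_{i,m}` on `f_{k,r}`. -/
def derCoeff (A : GCM I) (i : I) (m : ℤ) (k : I) (r : ℤ) : 𝕂 :=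
  if k = i ∧ r = m + 1 then 1 - qd A i ^ 2 else 0

lemma derCoeff_ne_zero {A : GCM I} {i k : I} {m r : ℤ} (h : derCoeff A i m k r ≠ 0) :
    k = i ∧ r = m + 1 := by
  by_contra h'
  exact h (if_neg h')

/-- The matrix encoding the action of the skew derivation `D_{i,m}` on a generator. -/
def derMatrix (A : GCM I) (i : I) (m : ℤ) (k : I) (r : ℤ) : Matrix (Fin 2) (Fin 2) (SkewT A) :=
  upperTri (qh ^ (twistSign m r * (A.d i * A.c i k)) • tf A k r) (derCoeff A i m k r) (tf A k r)

section MatrixAux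

variable {R : Type} [Ring R] [Algebra 𝕂 R]

lemma upperTri_zero (a b : R) : upperTri a 0 b = Matrix.diagonal ![a, b] := by
  rw [upperTri_eq_add, zero_smul, corner_zero, add_zero]

lemma upperTri_mul (a b a' b' : R) (s s' : 𝕂) :
    upperTri a s b * upperTri a' s' b' = !![a * a', s' • a + s • b'; 0, b * b'] := by
  ext r c
  fin_cases r <;> fin_cases c <;> simp [upperTri, Matrix.mul_apply]

lemma diagonal_fin_two_eq_zero {a : Fin 2 → R} (h0 : a 0 = 0) (h1 : a 1 = 0) :
    Matrix.diagonal a = 0 := by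
  ext r c
  fin_cases r <;> fin_cases c <;> simp [h0, h1]

end MatrixAux

lemma derMatrix_serre (A : GCM I) (i : I) (m : ℤ) {k l : I} (r : ℤ) (h : k ≠ l) :
    serreIn A k l (derMatrix A i m k r) (derMatrix A i m l r) = 0 := by
  have hz : ∀ s s' : 𝕂, serreIn A k l (s • tf A k r) (s' • tf A l r) = 0 := fun s s' => by
    rw [serreIn_smul, tf_serre A h, smul_zero]
  by_cases hr : r = m + 1
  · subst hr
    simp only [derMatrix, twistSign_succ_self, one_mul]
    rw [serreIn_upperTri_upper A h i _ _ _ _ (fun h0 => (derCoeff_ne_zero h0).1)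
      (fun h0 => (derCoeff_ne_zero h0).1)]
    exact diagonal_fin_two_eq_zero (hz _ _) (tf_serre A h _)
  · have h0 : ∀ k, derCoeff A i m k r = 0 := fun k => if_neg fun h => hr h.2
    simp only [derMatrix, h0, upperTri_zero, serreIn_diagonal]
    exact diagonal_fin_two_eq_zero (hz _ _) (tf_serre A h _)

lemma derMatrix_comm (A : GCM I) (i : I) (m : ℤ) (k l : I) {r s : ℤ} (h : r < s) :
    derMatrix A i m k r * derMatrix A i m l s =
      qh ^ (((s - r + 1).negOnePow : ℤ) * (A.d k * A.c k l)) •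
        (derMatrix A i m l s * derMatrix A i m k r) := by
  have hcorner : derCoeff A i m l s • (qh ^ (twistSign m r * (A.d i * A.c i k)) • tf A k r) +
      derCoeff A i m k r • tf A l s =
      qh ^ (((s - r + 1).negOnePow : ℤ) * (A.d k * A.c k l)) •
        (derCoeff A i m k r • (qh ^ (twistSign m s * (A.d i * A.c i l)) • tf A l s) +
          derCoeff A i m l s • tf A k r) := by
    by_cases h1 : derCoeff A i m l s = 0
    · by_cases h2 : derCoeff A i m k r = 0
      · simp [h1, h2]
      · obtain ⟨rfl, rfl⟩ := derCoeff_ne_zero h2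
        rw [h1, twistSign_of_succ_lt h, neg_mul, zpow_neg]
        simp only [zero_smul, zero_mul, zero_add, add_zero, smul_smul]
        congr 1
        have := zpow_ne_zero (((s - (m + 1) + 1).negOnePow : ℤ) * (A.d k * A.c k l)) qh_ne_zero
        field_simp
    · obtain ⟨rfl, rfl⟩ := derCoeff_ne_zero h1
      have h2 : derCoeff A l m k r = 0 := if_neg fun h' => by omega
      rw [h2, twistSign_of_lt_succ h, A.dsymm l k]
      simp only [zero_smul, zero_mul, zero_add, add_zero, smul_smul]
      rw [mul_comm]
  rw [derMatrix, derMatrix, upperTri_mul, upperTri_mul, hcorner]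
  ext x y
  fin_cases x <;> fin_cases y
  · simp [tf_comm A k l h, smul_smul]
    congr 1
    ring
  · simp
  · simp
  · simp [tf_comm A k l h]

/-- The algebra homomorphism `x ↦ !![σ x, D x; 0, x]` attached to `D_{i,m}`. -/
def derHom (A : GCM I) (i : I) (m : ℤ) : SkewT A →ₐ[𝕂] Matrix (Fin 2) (Fin 2) (SkewT A) :=
  skewLift A (derMatrix A i m) (fun _ _ p h => derMatrix_serre A i m p h)
    fun k l _ _ h => derMatrix_comm A i m k l h

lemma derHom_tf (A : GCM I) (i : I) (m : ℤ) (k : I) (r : ℤ) :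
    derHom A i m (tf A k r) = derMatrix A i m k r := skewLift_tf _ _ _ _ _ _

lemma derHom_lower (A : GCM I) (i : I) (m : ℤ) (x : SkewT A) : derHom A i m x 1 1 = x := by
  let W : Submodule 𝕂 (SkewT A) :=
    { carrier := {x | derHom A i m x 1 1 = x}
      add_mem' := fun {a b} ha hb => by
        simp only [Set.mem_ofPred_eq] at *
        rw [map_add, Matrix.add_apply, ha, hb]
      zero_mem' := by simp
      smul_mem' := fun c a ha => by
        simp only [Set.mem_ofPred_eq] at *
        rw [map_smul, Matrix.smul_apply, ha] }
  refine SkewT.mem_of_mul_mem W (by simp [W]) (fun k r y hy => ?_) x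
  change derHom A i m (tf A k r * y) 1 1 = tf A k r * y
  have hy' : derHom A i m y 1 1 = y := hy
  rw [map_mul, derHom_tf, Matrix.mul_apply, Fin.sum_univ_two, hy']
  simp [derMatrix, upperTri]

/-- The skew derivation `D_{i,m}` of the skew tensor product. -/
def der (A : GCM I) (i : I) (m : ℤ) : Module.End 𝕂 (SkewT A) where
  toFun x := derHom A i m x 0 1
  map_add' x y := by rw [map_add, Matrix.add_apply]
  map_smul' c x := by rw [map_smul, Matrix.smul_apply, RingHom.id_apply]

/-- Left multiplication by `f_{i,p}` on the skew tensor product. -/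
def lm (A : GCM I) (i : I) (p : ℤ) : Module.End 𝕂 (SkewT A) := LinearMap.mulLeft 𝕂 (tf A i p)

lemma lm_apply (A : GCM I) (i : I) (p : ℤ) (x : SkewT A) : lm A i p x = tf A i p * x := rfl

lemma der_one (A : GCM I) (i : I) (m : ℤ) : der A i m 1 = 0 := by
  change derHom A i m 1 0 1 = 0
  rw [map_one]
  rfl

lemma der_mul_lm (A : GCM I) (i : I) (m : ℤ) (k : I) (r : ℤ) :
    der A i m * lm A k r =
      qh ^ (twistSign m r * (A.d i * A.c i k)) • (lm A k r * der A i m) +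
        derCoeff A i m k r • 1 := by
  ext x
  change derHom A i m (tf A k r * x) 0 1 =
    (_ : 𝕂) • (tf A k r * derHom A i m x 0 1) + (_ : 𝕂) • x
  rw [map_mul, derHom_tf, Matrix.mul_apply, Fin.sum_univ_two, derHom_lower]
  simp [derMatrix, upperTri]

/-- An operator killing `1` and skew commuting with left multiplications vanishes. -/
lemma eq_zero_of_skew_commute (A : GCM I) (Z : Module.End 𝕂 (SkewT A)) (h1 : Z 1 = 0)
    (h : ∀ k r, ∃ s : 𝕂, Z * lm A k r = s • (lm A k r * Z)) : Z = 0 := by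
  ext x
  refine SkewT.mem_of_mul_mem (LinearMap.ker Z) h1 (fun k r y hy => ?_) x
  obtain ⟨s, hs⟩ := h k r
  have := LinearMap.congr_fun hs y
  rw [LinearMap.mem_ker] at hy ⊢
  change Z (tf A k r * y) = s • (tf A k r * Z y) at this
  rw [hy, mul_zero, smul_zero] at this
  exact this

lemma der_mul_der_mul_lm (A : GCM I) (i j k : I) (m p r : ℤ) :
    der A i m * der A j p * lm A k r =
      (qh ^ (twistSign m r * (A.d i * A.c i k)) * qh ^ (twistSign p r * (A.d j * A.c j k))) •
        (lm A k r * (der A i m * der A j p)) +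
      ((qh ^ (twistSign p r * (A.d j * A.c j k)) * derCoeff A i m k r) • der A j p +
        derCoeff A j p k r • der A i m) := by
  rw [mul_assoc, der_mul_lm, mul_add, mul_smul_comm, ← mul_assoc (der A i m) (lm A k r),
    der_mul_lm, add_mul, smul_add, smul_mul_assoc, smul_mul_assoc, smul_smul, smul_smul,
    mul_smul_comm, mul_one, one_mul, mul_assoc (lm A k r),
    mul_comm (qh ^ (twistSign m r * _)), add_assoc]

lemma der_comm (A : GCM I) (i j : I) {m p : ℤ} (h : m < p) :
    der A i m * der A j p =
      qh ^ (((p - m + 1).negOnePow : ℤ) * (A.d i * A.c i j)) • (der A j p * der A i m) := by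
  refine sub_eq_zero.1 (eq_zero_of_skew_commute A (der A i m * der A j p -
      qh ^ (((p - m + 1).negOnePow : ℤ) * (A.d i * A.c i j)) • (der A j p * der A i m)) ?_
    fun k r => ⟨qh ^ (twistSign m r * (A.d i * A.c i k)) *
      qh ^ (twistSign p r * (A.d j * A.c j k)), ?_⟩)
  · simp [der_one]
  have e3 : (qh ^ (twistSign p r * (A.d j * A.c j k)) * derCoeff A i m k r) • der A j p +
        derCoeff A j p k r • der A i m =
      qh ^ (((p - m + 1).negOnePow : ℤ) * (A.d i * A.c i j)) •
      ((qh ^ (twistSign m r * (A.d i * A.c i k)) * derCoeff A j p k r) • der A i m +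
        derCoeff A i m k r • der A j p) := by
    by_cases h1 : derCoeff A i m k r = 0
    · by_cases h2 : derCoeff A j p k r = 0
      · simp [h1, h2]
      · obtain ⟨rfl, rfl⟩ := derCoeff_ne_zero h2
        rw [h1, twistSign_succ_of_lt h, neg_mul, zpow_neg]
        simp only [mul_zero, zero_smul, zero_add, add_zero, smul_smul]
        congr 1
        have := zpow_ne_zero (((p - m + 1).negOnePow : ℤ) * (A.d i * A.c i k)) qh_ne_zero
        field_simp
    · obtain ⟨rfl, rfl⟩ := derCoeff_ne_zero h1
      have h2 : derCoeff A j p k (m + 1) = 0 := if_neg fun h' => by omega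
      rw [h2, twistSign_succ_right h, A.dsymm j k]
      simp only [mul_zero, zero_smul, zero_add, add_zero, smul_smul]
  rw [sub_mul, smul_mul_assoc, der_mul_der_mul_lm, der_mul_der_mul_lm A j i, e3, mul_sub,
    mul_smul_comm, mul_comm (qh ^ (twistSign p r * _)) (qh ^ (twistSign m r * _)), smul_sub,
    smul_add _ ((_ * _) • (_ * _)),
    smul_comm (qh ^ (((p - m + 1).negOnePow : ℤ) * (A.d i * A.c i j))) (_ * _) (_ * _)]
  exact add_sub_add_right_eq_sub _ _ _

lemma serreIn_apply_of_apply_eq_zero (A : GCM I) {i j : I} {M : Type} [AddCommGroup M] [Module 𝕂 M]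
    {X Y : Module.End 𝕂 M} {v : M} (hX : X v = 0) (hY : Y v = 0) :
    serreIn A i j X Y v = 0 := by
  simp only [serreIn, LinearMap.sum_apply, LinearMap.smul_apply]
  refine Finset.sum_eq_zero fun k _ => ?_
  rcases Nat.eq_zero_or_pos ((1 - A.c i j).toNat - k) with h | h
  · rw [h, pow_zero, mul_one, Module.End.mul_apply, hY, map_zero, smul_zero]
  · obtain ⟨n, hn⟩ := Nat.exists_eq_succ_of_ne_zero h.ne'
    rw [hn, pow_succ X, Module.End.mul_apply, Module.End.mul_apply,
      Module.End.mul_apply, hX, map_zero, map_zero, map_zero,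
      smul_zero]

lemma der_serre (A : GCM I) {i j : I} (h : i ≠ j) (m : ℤ) :
    serreIn A i j (der A i m) (der A j m) = 0 := by
  refine eq_zero_of_skew_commute A _
    (serreIn_apply_of_apply_eq_zero A (der_one A i m) (der_one A j m)) fun k r => ?_
  let tw : I → 𝕂 := fun a => qh ^ (twistSign m r * (A.d a * A.c a k))
  let C : Matrix (Fin 2) (Fin 2) (Module.End 𝕂 (SkewT A)) := !![lm A k r, 0; -1, 0]
  have hC : ∀ a, SemiconjBy C (Matrix.diagonal fun _ => tw a • der A a m)
      (upperTri (der A a m) (derCoeff A a m k r) (tw a • der A a m)) := by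
    intro a
    ext x y : 1
    fin_cases x <;> fin_cases y <;>
      simp [C, tw, upperTri, der_mul_lm, Matrix.mul_apply, Matrix.diagonal_apply]
    rw [(Commute.neg_one_left (der A a m)).eq]
  have hS := (hC i).serreIn A (hC j) i j
  have hdiag : serreIn A i j (upperTri (der A i m) (derCoeff A i m k r) (tw i • der A i m))
      (upperTri (der A j m) (derCoeff A j m k r) (tw j • der A j m)) =
      Matrix.diagonal fun s => serreIn A i j (![der A i m, tw i • der A i m] s)
        (![der A j m, tw j • der A j m] s) := by
    by_cases hr : r = m + 1
    · subst hr
      simp only [tw, twistSign_succ_self, one_mul]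
      exact serreIn_upperTri_lower A h k _ _ _ _ (fun h0 => (derCoeff_ne_zero h0).1.symm)
        (fun h0 => (derCoeff_ne_zero h0).1.symm)
    · have h0 : ∀ a, derCoeff A a m k r = 0 := fun a => if_neg fun h => hr h.2
      simp only [h0, upperTri_zero, serreIn_diagonal]
  rw [hdiag, serreIn_diagonal, serreIn_smul] at hS
  have h00 := congrFun (congrFun hS 0) 0
  refine ⟨tw i ^ (1 - A.c i j).toNat * tw j, ?_⟩
  simp [C, Matrix.mul_apply] at h00
  exact h00.symm

/-- The operator by which `f_{i,p}` acts on the skew tensor product. -/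
def fockOp (A : GCM I) (i : I) (p : ℤ) : Module.End 𝕂 (SkewT A) := lm A i p + der A i p

lemma lm_serre (A : GCM I) {i j : I} (h : i ≠ j) (p : ℤ) :
    serreIn A i j (lm A i p) (lm A j p) = 0 := by
  have := serreIn_map A (Algebra.lmul 𝕂 (SkewT A)) i j (tf A i p) (tf A j p)
  rw [tf_serre A h, map_zero] at this
  exact this.symm

lemma lm_comm (A : GCM I) (i j : I) {m p : ℤ} (h : m < p) :
    lm A i m * lm A j p =
      qh ^ (((p - m + 1).negOnePow : ℤ) * (A.d i * A.c i j)) • (lm A j p * lm A i m) := by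
  have := congrArg (Algebra.lmul 𝕂 (SkewT A)) (tf_comm A i j h)
  rw [map_mul, map_smul, map_mul] at this
  exact this

lemma fockOp_serre (A : GCM I) {i j : I} (h : i ≠ j) (p : ℤ) :
    serreIn A i j (fockOp A i p) (fockOp A j p) = 0 := by
  have hc : ∀ a b, der A a p * lm A b p = qh ^ (A.d a * A.c a b) • (lm A b p * der A a p) := by
    intro a b
    have h0 : derCoeff A a p b p = 0 := if_neg fun h => by omega
    rw [der_mul_lm, twistSign_self, h0, one_mul, zero_smul, add_zero]
  rw [fockOp, fockOp, serreIn_add A h (hc i i) (hc i j) (by rw [hc j i, A.dsymm j i]),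
    lm_serre A h, der_serre A h, add_zero]

lemma fockOp_comm (A : GCM I) (i j : I) {m p : ℤ} (h : m < p) :
    fockOp A i m * fockOp A j p =
      qh ^ (((p - m + 1).negOnePow : ℤ) * (A.d i * A.c i j)) • (fockOp A j p * fockOp A i m) +
        derCoeff A i m j p • 1 := by
  have h0 : derCoeff A j p i m = 0 := if_neg fun h => by omega
  have h1 : lm A i m * der A j p =
      qh ^ (((p - m + 1).negOnePow : ℤ) * (A.d i * A.c i j)) • (der A j p * lm A i m) := by
    rw [der_mul_lm, h0, twistSign_swap h, A.dsymm j i, zero_smul, add_zero, smul_smul, neg_mul,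
      zpow_neg, mul_inv_cancel₀ (zpow_ne_zero _ qh_ne_zero), one_smul]
  simp only [fockOp, add_mul, mul_add]
  rw [lm_comm A i j h, h1, der_comm A i j h, der_mul_lm, twistSign_of_lt h]
  simp only [smul_add]
  abel

/-- The Fock representation of the bosonic extension. -/
def fock (A : GCM I) : hA A →ₐ[𝕂] Module.End 𝕂 (SkewT A) :=
  RingQuot.liftAlgHom 𝕂 ⟨FreeAlgebra.lift 𝕂 fun p => fockOp A p.1 p.2, by
    rintro _ _ (⟨i, j, p, h⟩ | ⟨i, j, m, p, h⟩)
    · simpa [serreIn_map] using fockOp_serre A h p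
    · have := fockOp_comm A i j h
      rw [derCoeff] at this
      split_ifs at this ⊢ <;> simpa using this⟩

lemma fock_ff (A : GCM I) (i : I) (p : ℤ) : fock A (ff A i p) = fockOp A i p := by
  refine (RingQuot.liftAlgHom_mkAlgHom_apply 𝕂 _ _ _).trans ?_
  exact FreeAlgebra.lift_ι_apply _ _

/-- Algebra homomorphisms out of `U_q^-(g)`. -/
def uqLift (A : GCM I) {R : Type} [Ring R] [Algebra 𝕂 R] (g : I → R)
    (hserre : ∀ i j, i ≠ j → serreIn A i j (g i) (g j) = 0) : Uq A →ₐ[𝕂] R :=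
  RingQuot.liftAlgHom 𝕂 ⟨FreeAlgebra.lift 𝕂 g, by
    rintro _ _ ⟨i, j, h⟩
    simpa [serreIn_map] using hserre i j h⟩

lemma uqLift_fg (A : GCM I) {R : Type} [Ring R] [Algebra 𝕂 R] (g : I → R) (hs) (i : I) :
    uqLift A g hs (fg A i) = g i := by
  refine (RingQuot.liftAlgHom_mkAlgHom_apply 𝕂 _ _ _).trans ?_
  exact FreeAlgebra.lift_ι_apply _ _

lemma fg_serre (A : GCM I) {i j : I} (h : i ≠ j) : serreIn A i j (fg A i) (fg A j) = 0 := by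
  have := RingQuot.mkAlgHom_rel 𝕂 (URel.serre (A := A) i j h)
  rwa [serreIn_map, map_zero] at this

lemma ff_serre (A : GCM I) {i j : I} (h : i ≠ j) (p : ℤ) :
    serreIn A i j (ff A i p) (ff A j p) = 0 := by
  have := RingQuot.mkAlgHom_rel 𝕂 (hARel.serre (A := A) i j p h)
  rwa [serreIn_map, map_zero] at this

/-- The homomorphism `L_m : U_q^-(g) → Â`. -/
def bosonicHom (A : GCM I) (m : ℤ) : Uq A →ₐ[𝕂] hA A :=
  uqLift A (fun i => ff A i m) fun _ _ h => ff_serre A h m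

/-- The inclusion of `U_q^-(g)` as the `m`-th factor of the skew tensor product. -/
def slotHom (A : GCM I) (m : ℤ) : Uq A →ₐ[𝕂] SkewT A :=
  uqLift A (fun i => tf A i m) fun _ _ h => tf_serre A h m

/-- The projection of the skew tensor product onto its `m`-th factor. -/
def slotProj (A : GCM I) (m : ℤ) : SkewT A →ₐ[𝕂] Uq A :=
  skewLift A (fun i p => if p = m then fg A i else 0)
    (fun i j p h => by
      by_cases hp : p = m
      · simpa [hp] using fg_serre A h
      · simpa [hp] using serreIn_eq_zero A h (mul_zero (0 : Uq A)) (mul_zero 0))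
    (fun i j r s h => by
      by_cases hr : r = m
      · simp [show s ≠ m by omega]
      · simp [hr])

lemma slotProj_slotHom (A : GCM I) (m : ℤ) (x : Uq A) : slotProj A m (slotHom A m x) = x := by
  have : (slotProj A m).comp (slotHom A m) = AlgHom.id 𝕂 (Uq A) := by
    refine RingQuot.ringQuot_ext' 𝕂 _ _ (FreeAlgebra.hom_ext (funext fun i => ?_))
    change slotProj A m (slotHom A m (fg A i)) = fg A i
    rw [slotHom, uqLift_fg, slotProj, skewLift_tf, if_pos rfl]
  exact AlgHom.congr_fun this x

lemma slotHom_fg_mul (A : GCM I) (m : ℤ) (i : I) (x : Uq A) :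
    slotHom A m (fg A i * x) = tf A i m * slotHom A m x := by
  rw [map_mul, slotHom, uqLift_fg]

lemma der_slotHom (A : GCM I) (m : ℤ) (i : I) (x : Uq A) : der A i m (slotHom A m x) = 0 := by
  refine RingQuot.mem_of_mul_mem (LinearMap.ker (der A i m ∘ₗ (slotHom A m).toLinearMap)) ?_
    (fun k y hy => ?_) x
  · change der A i m (slotHom A m 1) = 0
    rw [map_one, der_one]
  · replace hy : der A i m (slotHom A m y) = 0 := hy
    change der A i m (slotHom A m (fg A k * y)) = 0
    have h0 : derCoeff A i m k m = 0 := if_neg fun h => by omega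
    have := LinearMap.congr_fun (der_mul_lm A i m k m) (slotHom A m y)
    simp only [h0, zero_smul, add_zero, Module.End.mul_apply, LinearMap.smul_apply, hy, map_zero,
      smul_zero, lm_apply] at this
    rw [slotHom_fg_mul, this]

lemma fock_bosonicHom (A : GCM I) (m : ℤ) (x : Uq A) :
    fock A (bosonicHom A m x) 1 = slotHom A m x := by
  refine RingQuot.mem_of_mul_mem (LinearMap.eqLocus
    ((LinearMap.applyₗ (1 : SkewT A)) ∘ₗ ((fock A).comp (bosonicHom A m)).toLinearMap)
    (slotHom A m).toLinearMap) ?_ (fun k y hy => ?_) x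
  · change fock A (bosonicHom A m 1) 1 = slotHom A m 1
    rw [map_one (bosonicHom A m), map_one (fock A), map_one (slotHom A m)]
    rfl
  · replace hy : fock A (bosonicHom A m y) 1 = slotHom A m y := hy
    change fock A (bosonicHom A m (fg A k * y)) 1 = slotHom A m (fg A k * y)
    have hk : bosonicHom A m (fg A k) = ff A k m := uqLift_fg _ _ _ _
    rw [map_mul, hk, map_mul, fock_ff, Module.End.mul_apply, hy, fockOp, LinearMap.add_apply,
      der_slotHom, add_zero, lm_apply, slotHom_fg_mul]

lemma bosonicHom_injective (A : GCM I) (m : ℤ) : Function.Injective (bosonicHom A m) := by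
  intro x y h
  rw [← slotProj_slotHom A m x, ← fock_bosonicHom, h, fock_bosonicHom, slotProj_slotHom]

lemma bosonicHom_range (A : GCM I) (m : ℤ) : (bosonicHom A m).range = hAk A m := by
  have hk : ∀ k, bosonicHom A m (fg A k) = ff A k m := fun k => uqLift_fg _ _ _ _
  apply le_antisymm
  · rintro _ ⟨x, rfl⟩
    refine RingQuot.mem_of_mul_mem
      ((Subalgebra.toSubmodule (hAk A m)).comap (bosonicHom A m).toLinearMap) ?_
      (fun k y hy => ?_) x
    · change bosonicHom A m 1 ∈ hAk A m
      rw [map_one]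
      exact one_mem _
    · change bosonicHom A m (fg A k * y) ∈ hAk A m
      rw [map_mul, hk]
      exact mul_mem (Algebra.subset_adjoin ⟨k, m, le_rfl, le_rfl, rfl⟩) hy
  · refine Algebra.adjoin_le ?_
    rintro _ ⟨i, k, h1, h2, rfl⟩
    obtain rfl := le_antisymm h1 h2
    exact ⟨fg A i, hk i⟩

/-- for each `m ∈ ℤ`, the algebra homomorphism
`L_m : ℚ(q^{1/2}) ⊗_{ℚ(q)} U_q^-(g) → Â[m]` determined by `f_i ↦ f_{i,m}` exists and is an
isomorphism onto `Â[m]` (injective with range exactly `Â[m]`). -/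
theorem statement6 (A : GCM I) (m : ℤ) :
    ∃ L : Uq A →ₐ[𝕂] hA A,
      (∀ i, L (fg A i) = ff A i m) ∧ Function.Injective L ∧ L.range = hAk A m := by
  exact ⟨bosonicHom A m, fun i => uqLift_fg _ _ _ i, bosonicHom_injective A m, bosonicHom_range A m⟩

end
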